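/- Every T2 subshift is T1: if Σ ⊆ A^ℕ is a sofic subshift that includes an infinite transitive subshift, then there exist k ∈ ℕ* and a 2-SFT Γ ⊆ (A^k)^ℕ with π_0(Γ) = π(Γ) = Σ. -/

import Mathlib

variable {A : Type*}

/-- The onesided shift on `A^ℕ`. -/
def shiftN (z : ℕ → A) : ℕ → A := fun i => z (i + 1)

/-- The twosided shift on `A^ℤ`. -/
def shiftZ (x : ℤ → A) : ℤ → A := fun i => x (i + 1)

/-- A (onesided) subshift: a closed, shift-stable set of infinite words. -/
def IsSubshift [TopologicalSpace A] (S : Set (ℕ → A)) : Prop :=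
  IsClosed S ∧ ∀ z ∈ S, shiftN z ∈ S

/-- A 2-SFT: a subshift given by a set of forbidden words of length 2. -/
def IsTwoSFT (S : Set (ℕ → A)) : Prop :=
  ∃ Fb : Set (A × A), S = {z | ∀ i : ℕ, (z i, z (i + 1)) ∉ Fb}

/-- A k-SFT: a subshift given by a set of forbidden words of length k. -/
def IsKSFT (k : ℕ) (S : Set (ℕ → A)) : Prop :=
  ∃ Fb : Set (Fin k → A), S = {z | ∀ i : ℕ, (fun j : Fin k => z (i + (j : ℕ))) ∉ Fb}

/-- A subshift of finite type. -/
def IsSFT (S : Set (ℕ → A)) : Prop := ∃ k : ℕ, IsKSFT k S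

/-- A cellular automaton: a continuous self-map of `A^ℤ` commuting with the shift. -/
def IsCA [TopologicalSpace A] (F : (ℤ → A) → (ℤ → A)) : Prop :=
  Continuous F ∧ ∀ x, F (shiftZ x) = shiftZ (F x)

/-- The trace of `F` with initial condition `x`: the 0th column of the space-time diagram. -/
def caTrace (F : (ℤ → A) → (ℤ → A)) (x : ℤ → A) : ℕ → A := fun j => F^[j] x 0

/-- The trace subshift of `F`. -/
def traceSubshift (F : (ℤ → A) → (ℤ → A)) : Set (ℕ → A) := Set.range (caTrace F)

/-- A subshift is traceable if it is the trace subshift of some CA. -/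
def Traceable [TopologicalSpace A] (S : Set (ℕ → A)) : Prop :=
  ∃ F : (ℤ → A) → (ℤ → A), IsCA F ∧ traceSubshift F = S

/-- The q-th projection of an infinite word over the alphabet `A^k`. -/
def proj {k : ℕ} (q : Fin k) (z : ℕ → (Fin k → A)) : ℕ → A := fun j => z j q

/-- `π(Γ)`: the union of all projections. -/
def projAll {k : ℕ} (Γ : Set (ℕ → (Fin k → A))) : Set (ℕ → A) :=
  ⋃ q : Fin k, proj q '' Γ

/-- A subshift `S` on `A` is T1 if there is a 2-SFT `Γ ⊆ (A^k)^ℕ` with `π₀(Γ) = π(Γ) = S`. -/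
def IsT1 (S : Set (ℕ → A)) : Prop :=
  ∃ k : ℕ, ∃ hk : 0 < k, ∃ Γ : Set (ℕ → (Fin k → A)),
    IsTwoSFT Γ ∧ proj (⟨0, hk⟩ : Fin k) '' Γ = S ∧ projAll Γ = S

/-- A onesided CA: one admitting a local rule of anchor 0. -/
def IsOnesidedCA {C : Type*} (F : (ℤ → C) → (ℤ → C)) : Prop :=
  ∃ d : ℕ, ∃ f : (Fin d → C) → C, ∀ x i, F x i = f (fun j => x (i + (j : ℕ)))

/-- `S` is the k-trace of a onesided CA on some alphabet `B ⊆ A^k`. -/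
def KTraceable (k : ℕ) (S : Set (ℕ → A)) : Prop :=
  ∃ B : Set (Fin k → A), ∃ F : (ℤ → ↥B) → (ℤ → ↥B), IsOnesidedCA F ∧
    S = ⋃ q : Fin k, (fun z : ℕ → ↥B => fun j => ((z j : Fin k → A) q)) '' Set.range (caTrace F)

/-- `S` is a factor of `Γ`: a surjective continuous shift-commuting map from `Γ` onto `S`. -/
def IsFactorOf {B : Type*} [TopologicalSpace A] [TopologicalSpace B]
    (S : Set (ℕ → A)) (Γ : Set (ℕ → B)) : Prop :=
  ∃ φ : (ℕ → B) → (ℕ → A), ContinuousOn φ Γ ∧ φ '' Γ = S ∧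
    ∀ z ∈ Γ, φ (shiftN z) = shiftN (φ z)

/-- The language of a subshift: all finite factors of its elements. -/
def lang (S : Set (ℕ → A)) : Language A :=
  {w | ∃ z ∈ S, ∃ i : ℕ, w = List.ofFn (fun j : Fin w.length => z (i + (j : ℕ)))}

/-- A transitive subshift. -/
def IsTransitiveSubshift (S : Set (ℕ → A)) : Prop :=
  ∀ u ∈ lang S, ∀ v ∈ lang S, ∃ w : List A, u ++ w ++ v ∈ lang S

/-- A T2 subshift: sofic, and including an infinite transitive subshift. -/
def IsT2 [TopologicalSpace A] (S : Set (ℕ → A)) : Prop :=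
  (lang S).IsRegular ∧ ∃ Γ ⊆ S, IsSubshift Γ ∧ Γ.Infinite ∧ IsTransitiveSubshift Γ

/-- `B^ω`: infinite concatenations of words from `B ⊆ A^k`. -/
def Bomega {k : ℕ} (B : Set (Fin k → A)) : Set (ℕ → A) :=
  {z | ∀ i : ℕ, (fun q : Fin k => z (i * k + (q : ℕ))) ∈ B}

/-- A T3 subshift: T0 via a map `φ`, together with a periodic word `w ∉ φ(A)^*`. -/
def IsT3 (S : Set (ℕ → A)) : Prop :=
  ∃ φ : A → A, (∀ a : A, (fun j => φ^[j] a) ∈ S) ∧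
    ∃ w : List A, w ≠ [] ∧ (∃ a ∈ w, a ∉ Set.range φ) ∧
      ∃ z ∈ S, (∀ j : ℕ, z (j + w.length) = z j) ∧ ∀ i : Fin w.length, z (i : ℕ) = w.get i

/-! ### Reduction to an arbitrary finite index set -/

/-- To show that `S` is T1, it suffices to give a 2-step constraint on columns indexed by any
finite type with a distinguished index. -/
theorem isT1_of_step {ι : Type*} [Fintype ι] (i₀ : ι) {S : Set (ℕ → A)}
    (R : (ι → A) → (ι → A) → Prop)
    (hmem : ∀ z : ℕ → ι → A, (∀ j, R (z j) (z (j + 1))) → ∀ i, (fun j => z j i) ∈ S)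
    (hsurj : ∀ y ∈ S, ∃ z : ℕ → ι → A, (∀ j, R (z j) (z (j + 1))) ∧ ∀ j, z j i₀ = y j) :
    IsT1 S := by
  have hk : 0 < Fintype.card ι := Fintype.card_pos_iff.mpr ⟨i₀⟩
  obtain ⟨e, he⟩ : ∃ e : ι ≃ Fin (Fintype.card ι), e i₀ = ⟨0, hk⟩ :=
    ⟨(Fintype.equivFin ι).trans (Equiv.swap (Fintype.equivFin ι i₀) ⟨0, hk⟩), by simp⟩
  set Γ : Set (ℕ → (Fin (Fintype.card ι) → A)) :=
    {z | ∀ j : ℕ, (z j, z (j + 1)) ∉ {p : (Fin (Fintype.card ι) → A) × _ |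
      ¬ R (p.1 ∘ e) (p.2 ∘ e)}} with hΓ
  have hsub : ∀ q, proj q '' Γ ⊆ S := by
    rintro q _ ⟨z, hz, rfl⟩
    have : (fun j => z j (e (e.symm q))) ∈ S :=
      hmem (fun j => z j ∘ e) (fun j => by simpa using hz j) (e.symm q)
    rwa [e.apply_symm_apply] at this
  have hsup : S ⊆ proj (⟨0, hk⟩ : Fin _) '' Γ := by
    intro y hy
    obtain ⟨z, hz, hzy⟩ := hsurj y hy
    refine ⟨fun j => z j ∘ e.symm, fun j => ?_, ?_⟩
    · simpa [Function.comp_def] using hz j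
    · funext j
      simp [proj, ← he, hzy]
  refine ⟨_, hk, Γ, ⟨_, hΓ⟩, (hsub _).antisymm hsup, ?_⟩
  exact (Set.iUnion_subset hsub).antisymm
    (hsup.trans (Set.subset_iUnion (fun q => proj q '' Γ) ⟨0, hk⟩))

/-! ### Concatenations of blocks and their windows -/

/-- The concatenation of the blocks of length `n` that `l` associates to the symbols of `δ`. -/
def blockConcat {D : Type*} (n : ℕ) (l : D → ℕ → A) (δ : ℕ → D) (t : ℕ) : A :=
  l (δ (t / n)) (t % n)

/-- The windows of length `n`, at position `t`, of a family of concatenations. -/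
def blockWindow {D K : Type*} (n : ℕ) (l : K → D → ℕ → A) (δ : ℕ → D) (t : ℕ) :
    K × Fin n → A :=
  fun p => blockConcat n (l p.1) δ (t + p.2)

theorem blockConcat_add_mul {D : Type*} {n : ℕ} (hn : 0 < n) (l : D → ℕ → A) (δ : ℕ → D)
    (c t : ℕ) :
    blockConcat n l (fun m => δ (m + c)) t = blockConcat n l δ (t + n * c) := by
  simp [blockConcat, Nat.add_mul_div_left _ _ hn]

theorem blockConcat_mul_add {D : Type*} {n : ℕ} (hn : 0 < n) (l : D → ℕ → A) (δ : ℕ → D)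
    (m : ℕ) {i : ℕ} (hi : i < n) : blockConcat n l δ (n * m + i) = l (δ m) i := by
  rw [blockConcat, Nat.mul_add_div hn, Nat.div_eq_of_lt hi, Nat.mul_add_mod,
    Nat.mod_eq_of_lt hi, add_zero]

/-- The window at position `t` determines the symbol of the only block starting in it. -/
theorem eq_of_blockWindow_eq {D K : Type*} {n : ℕ} (hn : 0 < n) {l : K → D → ℕ → A}
    (hread : ∀ d d', (∀ κ, l κ d 0 = l κ d' 0) → d = d')
    {δ δ' : ℕ → D} {t t' : ℕ} (htt : t ≡ t' [MOD n])
    (h : blockWindow n l δ t = blockWindow n l δ' t') :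
    δ ((t + n - 1) / n) = δ' ((t' + n - 1) / n) := by
  have key : ∀ t, ∀ r, t % n = r →
      n * ((t + n - 1) / n) = t + (n - r) % n := by
    rintro t _ rfl
    obtain ⟨c, r, hr, rfl⟩ : ∃ c r, r < n ∧ t = n * c + r :=
      ⟨t / n, t % n, Nat.mod_lt _ hn, (Nat.div_add_mod t n).symm⟩
    have h1 : (n * c + r) % n = r := by simp [Nat.add_mod, Nat.mod_eq_of_lt hr]
    rw [h1]
    rcases Nat.eq_zero_or_pos r with rfl | hr0
    · have : (n * c + 0 + n - 1) / n = c := by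
        rw [show n * c + 0 + n - 1 = (n - 1) + n * c by omega, Nat.add_mul_div_left _ _ hn,
          Nat.div_eq_of_lt (by omega), zero_add]
      rw [this]; simp
    · have : (n * c + r + n - 1) / n = c + 1 := by
        have h2 : n * c + r + n - 1 = (r - 1) + n * (c + 1) := by
          rw [mul_add]; omega
        rw [h2, Nat.add_mul_div_left _ _ hn, Nat.div_eq_of_lt (by omega)]; omega
      rw [this, Nat.mod_eq_of_lt (by omega : n - r < n), mul_add]
      omega
  have hk := key t _ rfl
  have hk' := key t' _ htt.symm
  refine hread _ _ fun κ => ?_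
  have := congrFun h (κ, ⟨(n - t % n) % n, Nat.mod_lt _ hn⟩)
  simpa [blockWindow, blockConcat, ← hk, ← hk', hn] using this

/-- If windows determine their phase and the symbol of the block starting in them, then the
windows of compatible concatenations are described by a 2-step constraint. -/
theorem exists_eq_blockWindow {D K : Type*} {n : ℕ} (hn : 0 < n) {C : D → D → Prop}
    {l : K → D → ℕ → A}
    (hphase : ∀ δ δ' t t', blockWindow n l δ t = blockWindow n l δ' t' → t ≡ t' [MOD n])
    (hread : ∀ d d', (∀ κ, l κ d 0 = l κ d' 0) → d = d')
    {z : ℕ → K × Fin n → A}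
    (hz : ∀ j, ∃ δ : ℕ → D, (∀ m, C (δ m) (δ (m + 1))) ∧ ∃ t,
      z j = blockWindow n l δ t ∧ z (j + 1) = blockWindow n l δ (t + 1)) :
    ∃ δ : ℕ → D, (∀ m, C (δ m) (δ (m + 1))) ∧ ∃ t, ∀ j, z j = blockWindow n l δ (t + j) := by
  have hz' : ∀ j, ∃ δ : ℕ → D, ∃ t, (∀ m, C (δ m) (δ (m + 1))) ∧ t < n ∧
      z j = blockWindow n l δ t ∧ z (j + 1) = blockWindow n l δ (t + 1) := by
    intro j
    obtain ⟨δ, hδ, t, h1, h2⟩ := hz j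
    refine ⟨fun m => δ (m + t / n), t % n, fun m => ?_, Nat.mod_lt _ hn, ?_, ?_⟩
    · simpa only [Nat.add_right_comm m 1] using hδ (m + t / n)
    · rw [h1]; funext p
      simp only [blockWindow, blockConcat_add_mul hn]
      congr 1
      have := Nat.mod_add_div t n
      omega
    · rw [h2]; funext p
      simp only [blockWindow, blockConcat_add_mul hn]
      congr 1
      have := Nat.mod_add_div t n
      omega
  choose Δ τ hΔ hτ h1 h2 using hz'
  obtain ⟨rev, hrev⟩ : ∃ rev : ℕ → D, ∀ j, rev j = Δ j ((τ j + n - 1) / n) := ⟨_, fun _ => rfl⟩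
  have hmod : ∀ j, τ (j + 1) ≡ τ j + 1 [MOD n] := fun j =>
    hphase _ _ _ _ ((h1 (j + 1)).symm.trans (h2 j))
  have hrev0 : ∀ j, τ j = 0 → rev j = Δ j 0 := by
    intro j hj
    rw [hrev, hj, Nat.div_eq_of_lt (by omega)]
  have hrev1 : ∀ j, τ j ≠ 0 → rev j = Δ j 1 := by
    intro j hj
    rw [hrev, show τ j + n - 1 = (τ j - 1) + n * 1 by omega, Nat.add_mul_div_left _ _ hn,
      Nat.div_eq_of_lt (by have := hτ j; omega)]
  have hrevs : ∀ j, rev (j + 1) = Δ j 1 := by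
    intro j
    rw [hrev, eq_of_blockWindow_eq hn hread (hmod j) ((h1 (j + 1)).symm.trans (h2 j)),
      show τ j + 1 + n - 1 = τ j + n * 1 by omega, Nat.add_mul_div_left _ _ hn,
      Nat.div_eq_of_lt (hτ j)]
  have hτj : ∀ j, τ j = (τ 0 + j) % n := by
    intro j
    induction j with
    | zero => simp [Nat.mod_eq_of_lt (hτ 0)]
    | succ j ih =>
      have h3 : τ (j + 1) % n = (τ j + 1) % n := hmod j
      rw [Nat.mod_eq_of_lt (hτ _), ih] at h3
      rw [h3, Nat.mod_add_mod, add_assoc]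
  obtain ⟨δ, hδ0, hδs⟩ : ∃ δ : ℕ → D, δ 0 = Δ 0 0 ∧
      ∀ c, δ (c + 1) = rev (n * c + 1 - τ 0) :=
    ⟨fun m => Nat.casesOn m (Δ 0 0) (fun c => rev (n * c + 1 - τ 0)), rfl, fun _ => rfl⟩
  have hδrev : ∀ j, rev j = δ ((τ 0 + j + n - 1) / n) := by
    intro j
    induction j with
    | zero =>
      by_cases h0 : τ 0 = 0
      · rw [hrev0 0 h0, h0, Nat.div_eq_of_lt (by omega), hδ0]
      · rw [show τ 0 + 0 + n - 1 = (τ 0 - 1) + n * 1 by omega, Nat.add_mul_div_left _ _ hn,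
          Nat.div_eq_of_lt (by have := hτ 0; omega), hδs]
        congr 1; omega
    | succ j ih =>
      have hdm := Nat.div_add_mod (τ 0 + j) n
      rw [← hτj j] at hdm
      set c := (τ 0 + j) / n
      by_cases h0 : τ j = 0
      · rw [show τ 0 + (j + 1) + n - 1 = 0 + n * (c + 1) by rw [mul_add]; omega,
          Nat.add_mul_div_left _ _ hn, Nat.zero_div, zero_add, hδs]
        congr 1; omega
      · have e1 : (τ 0 + (j + 1) + n - 1) / n = c + 1 := by
          rw [show τ 0 + (j + 1) + n - 1 = τ j + n * (c + 1) by rw [mul_add]; omega,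
            Nat.add_mul_div_left _ _ hn, Nat.div_eq_of_lt (hτ j), zero_add]
        have e2 : (τ 0 + j + n - 1) / n = c + 1 := by
          rw [show τ 0 + j + n - 1 = (τ j - 1) + n * (c + 1) by rw [mul_add]; omega,
            Nat.add_mul_div_left _ _ hn,
            Nat.div_eq_of_lt (by have := hτ j; omega), zero_add]
        rw [e1, ← e2, ← ih, hrevs, hrev1 j h0]
  have hδ1 : τ 0 ≠ 0 → δ 1 = Δ 0 1 := by
    intro h0
    rw [show (1 : ℕ) = 0 + 1 from rfl, hδs, show n * 0 + 1 - τ 0 = 0 by omega, hrev1 0 h0]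
  refine ⟨δ, fun m => ?_, τ 0, fun j => ?_⟩
  · by_cases hm : τ 0 ≤ n * m
    · obtain ⟨j, hj⟩ := Nat.exists_eq_add_of_le hm
      have h0 : τ j = 0 := by rw [hτj, ← hj]; simp
      have e1 : (τ 0 + j + n - 1) / n = m := by
        rw [← hj, show n * m + n - 1 = (n - 1) + n * m by omega, Nat.add_mul_div_left _ _ hn,
          Nat.div_eq_of_lt (by omega), zero_add]
      rw [← e1, ← hδrev j, hrev0 j h0, e1, hδs, show n * m + 1 - τ 0 = j + 1 by omega, hrevs]
      exact hΔ j 0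
    · have hm0 : m = 0 := by
        by_contra hne
        have := Nat.le_mul_of_pos_right n (Nat.pos_of_ne_zero hne)
        have := hτ 0
        omega
      subst hm0
      rw [hδ0, zero_add, hδ1 (by omega)]
      exact hΔ 0 0
  · induction j with
    | zero =>
      rw [h1 0]; funext ⟨κ, s⟩
      have hs := s.2
      have hT := hτ 0
      simp only [blockWindow, blockConcat, add_zero]
      by_cases h3 : τ 0 + s < n
      · rw [Nat.div_eq_of_lt h3, hδ0]
      · have e1 : (τ 0 + s) / n = 1 := by
          rw [show τ 0 + (s : ℕ) = (τ 0 + s - n) + n * 1 by omega, Nat.add_mul_div_left _ _ hn,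
            Nat.div_eq_of_lt (by omega)]
        rw [e1, hδ1 (by omega)]
    | succ j ih =>
      funext ⟨κ, s⟩
      by_cases hs : (s : ℕ) + 1 < n
      · have h3 := congrFun (h1 j) (κ, ⟨s + 1, hs⟩)
        rw [ih] at h3
        rw [h2 j]
        simp only [blockWindow] at h3 ⊢
        rw [show τ j + 1 + (s : ℕ) = τ j + (s + 1) by ring, ← h3]
        congr 1; ring
      · have hs' : (s : ℕ) = n - 1 := by have := s.2; omega
        rw [h1 (j + 1)]
        simp only [blockWindow, blockConcat, hs']
        rw [← Nat.add_sub_assoc hn, ← Nat.add_sub_assoc hn, ← hrev, ← hδrev]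
        congr 1
        rw [Nat.add_sub_assoc hn, Nat.add_sub_assoc hn, hτj (j + 1), Nat.mod_add_mod]

/-! ### Languages of subshifts -/

/-- The prefix of length `m` of an infinite word. -/
def initWord (z : ℕ → A) (m : ℕ) : List A := (List.range m).map z

@[simp] theorem length_initWord (z : ℕ → A) (m : ℕ) : (initWord z m).length = m := by
  simp [initWord]

theorem initWord_add (z : ℕ → A) (m k : ℕ) :
    initWord z (m + k) = initWord z m ++ initWord (fun i => z (m + i)) k := by
  simp [initWord, List.range_add, Function.comp_def]

theorem initWord_getD (w : List A) (a : A) :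
    initWord (fun i => w.getD i a) w.length = w := by
  apply List.ext_getElem <;> simp +contextual [initWord]

theorem initWord_congr {y z : ℕ → A} {m : ℕ} (h : ∀ i < m, y i = z i) :
    initWord y m = initWord z m := by
  simpa [initWord] using h

theorem eq_of_initWord_eq {y z : ℕ → A} {m : ℕ} (h : initWord y m = initWord z m) :
    ∀ i < m, y i = z i := by
  simpa [initWord] using h

theorem mem_lang_iff {S : Set (ℕ → A)} {w : List A} :
    w ∈ lang S ↔ ∃ z ∈ S, ∃ i, w = initWord (fun j => z (i + j)) w.length := by
  have h : ∀ (z : ℕ → A) (m : ℕ), List.ofFn (fun j : Fin m => z j) = initWord z m := by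
    intro z m
    apply List.ext_getElem <;> simp [initWord]
  constructor
  · rintro ⟨z, hz, i, hw⟩
    exact ⟨z, hz, i, hw.trans (h (fun j => z (i + j)) _)⟩
  · rintro ⟨z, hz, i, hw⟩
    exact ⟨z, hz, i, hw.trans (h (fun j => z (i + j)) _).symm⟩

theorem mem_lang_of_append_left {S : Set (ℕ → A)} {u v : List A} (h : u ++ v ∈ lang S) :
    v ∈ lang S := by
  obtain ⟨z, hz, i, hw⟩ := mem_lang_iff.1 h
  rw [List.length_append, initWord_add] at hw
  refine mem_lang_iff.2 ⟨z, hz, i + u.length, ?_⟩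
  simpa [add_assoc] using (List.append_inj hw (by simp)).2

theorem mem_lang_of_append_right {S : Set (ℕ → A)} {u v : List A} (h : u ++ v ∈ lang S) :
    u ∈ lang S := by
  obtain ⟨z, hz, i, hw⟩ := mem_lang_iff.1 h
  rw [List.length_append, initWord_add] at hw
  exact mem_lang_iff.2 ⟨z, hz, i, (List.append_inj hw (by simp)).1⟩

theorem initWord_mem_lang {S : Set (ℕ → A)} {z : ℕ → A} (hz : z ∈ S) (m : ℕ) :
    initWord z m ∈ lang S :=
  mem_lang_iff.2 ⟨z, hz, 0, by simp⟩

theorem lang_mono {S T : Set (ℕ → A)} (h : S ⊆ T) : ∀ w ∈ lang S, w ∈ lang T := by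
  rintro w ⟨z, hz, hw⟩
  exact ⟨z, h hz, hw⟩

theorem IsSubshift.shift_mem [TopologicalSpace A] {S : Set (ℕ → A)} (hS : IsSubshift S)
    {z : ℕ → A} (hz : z ∈ S) (i : ℕ) : (fun j => z (i + j)) ∈ S := by
  induction i with
  | zero => simpa using hz
  | succ i ih =>
    have := hS.2 _ ih
    unfold shiftN at this
    simpa only [add_assoc, add_comm 1] using this

/-- A point all of whose prefixes are in the language of a subshift belongs to it. -/
theorem IsSubshift.mem_of_initWord_mem [TopologicalSpace A] {S : Set (ℕ → A)}
    (hS : IsSubshift S) {z : ℕ → A} (h : ∀ m, initWord z m ∈ lang S) : z ∈ S := by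
  have h' : ∀ m, ∃ y ∈ S, ∀ i < m, y i = z i := by
    intro m
    obtain ⟨y, hy, i, hw⟩ := mem_lang_iff.1 (h m)
    rw [length_initWord] at hw
    exact ⟨_, hS.shift_mem hy i, fun j hj => (eq_of_initWord_eq hw j hj).symm⟩
  choose y hy hyz using h'
  refine hS.1.mem_of_tendsto (f := y) (b := Filter.atTop) ?_ (Filter.Eventually.of_forall hy)
  rw [tendsto_pi_nhds]
  intro i
  refine tendsto_const_nhds.congr' ?_
  filter_upwards [Filter.eventually_gt_atTop i] with m hm
  exact (hyz m i hm).symm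

/-! ### Reading blocks in an automaton -/

section Automaton

variable {σ : Type*} (M : DFA A σ)

theorem evalFrom_initWord_mul {n : ℕ} {z : ℕ → A} {q : ℕ → σ}
    (hq : ∀ m, q (m + 1) = M.evalFrom (q m) (initWord (fun i => z (n * m + i)) n)) (m : ℕ) :
    M.evalFrom (q 0) (initWord z (n * m)) = q m := by
  induction m with
  | zero => simp [initWord]
  | succ m ih => rw [mul_add, mul_one, initWord_add, DFA.evalFrom_of_append, ih, hq]

theorem evalFrom_initWord_mod {n : ℕ} {w : ℕ → A} {q : σ}
    (hw : M.evalFrom q (initWord w n) = q) (m : ℕ) :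
    M.evalFrom q (initWord (fun i => w (i % n)) (n * m)) = q := by
  refine evalFrom_initWord_mul M (q := fun _ => q) (fun m => ?_) m
  rw [initWord_congr (z := w), hw]
  intro i hi
  simp [Nat.add_mod, Nat.mod_eq_of_lt hi]

/-- The label of an accepting blockwise run belongs to the subshift. -/
theorem IsSubshift.mem_of_run [TopologicalSpace A] {S : Set (ℕ → A)} (hS : IsSubshift S)
    (hM : M.accepts = lang S) {n : ℕ} (hn : 0 < n) {z : ℕ → A} {q : ℕ → σ}
    (hq : ∀ m, q (m + 1) = M.evalFrom (q m) (initWord (fun i => z (n * m + i)) n))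
    {x : List A} (hx : M.eval x = q 0) (hacc : ∀ m, q m ∈ M.accept) : z ∈ S := by
  refine hS.mem_of_initWord_mem fun m => ?_
  have h1 : x ++ initWord z (n * m) ∈ lang S := by
    rw [← hM, DFA.mem_accepts, DFA.eval, DFA.evalFrom_of_append, ← DFA.eval, hx,
      evalFrom_initWord_mul M hq]
    exact hacc m
  have h2 := mem_lang_of_append_left h1
  obtain ⟨k, hk⟩ := Nat.exists_eq_add_of_le (Nat.le_mul_of_pos_left m hn)
  rw [hk, initWord_add] at h2
  exact mem_lang_of_append_right h2

/-- If the language of an infinite transitive subshift is accepted, then two loops of the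
automaton start from a same reachable accepting state with distinct letters. -/
theorem exists_loops [Finite σ] {S : Set (ℕ → A)}
    (hM : ∀ w ∈ lang S, w ∈ M.accepts) (hinf : S.Infinite) (htrans : IsTransitiveSubshift S) :
    ∃ (x : List A) (a b : A) (u v : List A), a ≠ b ∧ M.eval x ∈ M.accept ∧
      M.evalFrom (M.eval x) (a :: u) = M.eval x ∧ M.evalFrom (M.eval x) (b :: v) = M.eval x := by
  obtain ⟨z₀, hz₀⟩ := hinf.nonempty
  set reach : List A → Set σ := fun w => {q | ∃ y, w ++ y ∈ lang S ∧ M.eval (w ++ y) = q}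
  have hne : {w | w ∈ lang S}.Nonempty := ⟨_, initWord_mem_lang hz₀ 0⟩
  set w := Function.argminOn (fun w => (reach w).ncard) {w | w ∈ lang S} hne
  have hw : w ∈ lang S := Function.argminOn_mem (fun w => (reach w).ncard) _ hne
  have hmin : ∀ y, w ++ y ∈ lang S → reach (w ++ y) = reach w := by
    intro y hy
    refine Set.eq_of_subset_of_ncard_le ?_ ?_ (Set.toFinite _)
    · rintro q ⟨y', h1, h2⟩
      exact ⟨y ++ y', by simpa using h1, by simpa using h2⟩
    · exact Function.argminOn_le (fun w => (reach w).ncard) _ hy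
  have hloop : ∀ y a, w ++ y ++ [a] ∈ lang S →
      ∃ u, M.evalFrom (M.eval (w ++ y)) (a :: u) = M.eval (w ++ y) := by
    intro y a h
    have h1 : M.eval (w ++ y) ∈ reach w := ⟨y, mem_lang_of_append_right h, rfl⟩
    rw [← hmin (y ++ [a]) (by simpa using h)] at h1
    obtain ⟨u, -, hu⟩ := h1
    refine ⟨u, ?_⟩
    rw [DFA.eval, ← DFA.evalFrom_of_append, ← DFA.eval]
    simpa using hu
  by_contra! hcon
  have huniq : ∀ y y' a b, w ++ y ++ [a] ∈ lang S → w ++ y' ++ [b] ∈ lang S →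
      M.eval (w ++ y) = M.eval (w ++ y') → a = b := by
    intro y y' a b ha hb hyy
    by_contra hab
    obtain ⟨u, hu⟩ := hloop y a ha
    obtain ⟨v, hv⟩ := hloop y' b hb
    rw [← hyy] at hv
    exact hcon (w ++ y) a b u v hab (hM _ (mem_lang_of_append_right ha)) hu hv
  obtain ⟨f, hf⟩ : ∃ f : σ → A, ∀ y a, w ++ y ++ [a] ∈ lang S → a = f (M.eval (w ++ y)) := by
    have : ∀ q, ∃ b, ∀ y a, w ++ y ++ [a] ∈ lang S → M.eval (w ++ y) = q → a = b := by
      intro q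
      by_cases hq : ∃ y a, w ++ y ++ [a] ∈ lang S ∧ M.eval (w ++ y) = q
      · obtain ⟨y, b, hb, hy⟩ := hq
        exact ⟨b, fun y' a ha hy' => huniq y' y a b ha hb (hy'.trans hy.symm)⟩
      · exact ⟨z₀ 0, fun y a ha hy => absurd ⟨y, a, ha, hy⟩ hq⟩
    choose f hf using this
    exact ⟨f, fun y a ha => hf _ y a ha rfl⟩
  set label : σ → ℕ → A := fun q i => f ((fun q => M.step q (f q))^[i] q) with hlabel
  have hpath : ∀ (z : ℕ → A) (m : ℕ) (y : List A), w ++ y ++ initWord z m ∈ lang S →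
      ∀ i < m, z i = label (M.eval (w ++ y)) i := by
    intro z m
    induction m generalizing z with
    | zero => intro y _ i hi; omega
    | succ m ih =>
      intro y h i hi
      have e1 : initWord z (m + 1) = [z 0] ++ initWord (fun i => z (1 + i)) m := by
        rw [add_comm, initWord_add]; rfl
      rw [e1, ← List.append_assoc] at h
      have h0 := hf y _ (mem_lang_of_append_right h)
      rcases i with _ | i
      · simpa [hlabel] using h0
      · have h2 := ih (fun i => z (1 + i)) (y ++ [z 0]) (by simpa using h) i (by omega)
        have e2 : M.eval (w ++ (y ++ [z 0])) = M.step (M.eval (w ++ y)) (z 0) := by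
          rw [← List.append_assoc, DFA.eval_append_singleton]
        rw [e2] at h2
        rw [add_comm i 1, h2, h0]
        simp [hlabel, add_comm 1 i]
  refine hinf ((Set.finite_range label).subset fun z hz => ?_)
  have hex : ∀ m, ∃ q, ∀ i < m, z i = label q i := by
    intro m
    obtain ⟨c, hc⟩ := htrans w hw _ (initWord_mem_lang hz m)
    exact ⟨_, hpath z m c hc⟩
  choose q hq using hex
  obtain ⟨p, hp⟩ := Finite.exists_infinite_fiber q
  refine ⟨p, funext fun i => ?_⟩
  obtain ⟨m, hm, him⟩ := (Set.infinite_coe_iff.1 hp).exists_gt i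
  rw [hq m i him, hm]

end Automaton

/-! ### A word that determines its phase -/

/-- The word `u vⁿ⁻¹`, where `u` and `v` have length `n`, as a word of length `n * n`. -/
def phaseWord (n : ℕ) (u v : ℕ → A) (i : ℕ) : A := if i < n then u i else v (i % n)

theorem modEq_of_phaseWord {n : ℕ} (hn : 0 < n) {u v : ℕ → A} (huv : u 0 ≠ v 0) {t t' : ℕ}
    (h : ∀ s < n * n, phaseWord n u v ((t + s) % (n * n)) =
      phaseWord n u v ((t' + s) % (n * n))) : t ≡ t' [MOD n * n] := by
  wlog htt : t ≤ t' generalizing t t'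
  · exact (this (fun s hs => (h s hs).symm) (by omega)).symm
  obtain ⟨d, rfl⟩ := Nat.exists_eq_add_of_le htt
  have hN : 0 < n * n := Nat.mul_pos hn hn
  set f : ℕ → A := fun x => phaseWord n u v (x % (n * n)) with hf
  have hper : Function.Periodic f (n * n) := fun x => by simp [hf]
  have hd : Function.Periodic f d := by
    intro x
    obtain ⟨s, hs⟩ := Nat.exists_eq_add_of_le
      ((Nat.le_mul_of_pos_right t hN).trans (Nat.le_add_left _ x))
    have h1 : f (t + s) = f (t + d + s) := by
      have := h (s % (n * n)) (Nat.mod_lt _ hN)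
      simpa only [hf, Nat.add_mod_mod] using this
    have h2 : ∀ y, f (y + t * (n * n)) = f y := fun y => by simp [hf]
    rw [← h2 x, hs, h1, ← h2, show x + d + t * (n * n) = t + d + s by omega]
  have hblock : ∀ m, Function.Periodic f (n * m) → n ∣ m := by
    intro m hm
    by_contra hnm
    have h0 : f 0 = u 0 := by simp [hf, phaseWord, hn]
    have h1 : f (n * m) = v 0 := by
      have h2 : 0 < m % n := Nat.pos_of_ne_zero fun h => hnm (Nat.dvd_of_mod_eq_zero h)
      have h3 : ¬ n * (m % n) < n := not_lt.2 (Nat.le_mul_of_pos_right n h2)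
      simp [hf, phaseWord, Nat.mul_mod_mul_left, h3]
    have h2 := hm 0
    rw [zero_add, h0, h1] at h2
    exact huv h2.symm
  have h1 : n ∣ d := hblock d (by simpa using hd.nat_mul n)
  obtain ⟨e, rfl⟩ := h1
  obtain ⟨c, rfl⟩ := hblock e hd
  simp [Nat.ModEq, ← mul_assoc]

theorem evalFrom_phaseWord {σ : Type*} (M : DFA A σ) {n : ℕ} {u v : ℕ → A} {q : σ}
    (hu : M.evalFrom q (initWord u n) = q) (hv : M.evalFrom q (initWord v n) = q) :
    M.evalFrom q (initWord (phaseWord n u v) (n * n)) = q := by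
  refine evalFrom_initWord_mul M (q := fun _ => q) (fun m => ?_) n
  rcases Nat.eq_zero_or_pos m with rfl | hm
  · rw [initWord_congr (z := u), hu]
    intro i hi
    simp [phaseWord, hi]
  · rw [initWord_congr (z := v), hv]
    intro i hi
    have h := Nat.le_mul_of_pos_right n hm
    have h' : ¬ n * m + i < n := by omega
    simp [phaseWord, h', Nat.add_mod, Nat.mod_eq_of_lt hi]

/-! ### The main result -/

/-- Every T2 subshift (sofic, including an infinite transitive subshift)
is T1. -/
theorem stmt6 [Fintype A] [TopologicalSpace A] [DiscreteTopology A]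
    (hA : 2 ≤ Fintype.card A) (S : Set (ℕ → A)) (hS : IsSubshift S) (hT2 : IsT2 S) :
    IsT1 S := by
  classical
  obtain ⟨⟨σ, hσ, M, hM⟩, Λ, hΛS, -, hinf, htrans⟩ := hT2
  obtain ⟨x, a, b, u₀, v₀, hab, hacc, hu₀, hv₀⟩ := exists_loops M
    (fun w hw => hM ▸ lang_mono hΛS w hw) hinf htrans
  obtain ⟨n, hn⟩ : ∃ n, n = (a :: u₀).length * (b :: v₀).length := ⟨_, rfl⟩
  have hn0 : 0 < n := by simp [hn]
  have hN : 0 < n * n := Nat.mul_pos hn0 hn0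
  obtain ⟨u, hu, hu0⟩ : ∃ u : ℕ → A, M.evalFrom (M.eval x) (initWord u n) = M.eval x ∧
      u 0 = a :=
    ⟨_, hn ▸ evalFrom_initWord_mod M ((initWord_getD (a :: u₀) a).symm ▸ hu₀) _, by simp⟩
  obtain ⟨v, hv, hv0⟩ : ∃ v : ℕ → A, M.evalFrom (M.eval x) (initWord v n) = M.eval x ∧
      v 0 = b :=
    ⟨_, hn ▸ mul_comm (b :: v₀).length (a :: u₀).length ▸
      evalFrom_initWord_mod M ((initWord_getD (b :: v₀) b).symm ▸ hv₀) _, by simp⟩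
  have huv : u 0 ≠ v 0 := by rwa [hu0, hv0]
  have hU := evalFrom_phaseWord M hu hv
  have hV := evalFrom_initWord_mod M hv n
  set U := phaseWord n u v with hU_def
  set V : ℕ → A := fun i => v (i % n) with hV_def
  have hUV : U 0 ≠ V 0 := by simpa [hU_def, hV_def, phaseWord, hn0] using huv
  let D := σ × (Fin (n * n) → A)
  let l : Option (Option D) → D → ℕ → A
    | none => fun d i => d.2 ⟨i % (n * n), Nat.mod_lt _ hN⟩
    | some none => fun _ => U
    | some (some r) => fun d => if r = d then U else V
  let C : D → D → Prop := fun d d' => (∃ y, M.eval y = d.1) ∧ d.1 ∈ M.accept ∧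
    d'.1 = M.evalFrom d.1 (initWord (l none d) (n * n))
  have hblock : ∀ κ δ m, initWord (fun i => blockConcat (n * n) (l κ) δ (n * n * m + i)) (n * n)
      = initWord (l κ (δ m)) (n * n) := fun κ δ m =>
    initWord_congr fun i hi => blockConcat_mul_add hN _ _ _ hi
  have hcol : ∀ κ δ, (∀ m, C (δ m) (δ (m + 1))) → blockConcat (n * n) (l κ) δ ∈ S := by
    intro κ δ hδ
    rcases κ with _ | _ | r
    · obtain ⟨y, hy⟩ := (hδ 0).1
      refine hS.mem_of_run M hM hN (q := fun m => (δ m).1) (fun m => ?_) hy fun m => (hδ m).2.1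
      exact (hδ m).2.2.trans (congrArg (M.evalFrom _) (hblock none δ m).symm)
    · refine hS.mem_of_run M hM hN (q := fun _ => M.eval x) (fun m => ?_) rfl fun _ => hacc
      exact hU.symm.trans (congrArg (M.evalFrom _) (hblock (some none) δ m).symm)
    · refine hS.mem_of_run M hM hN (q := fun _ => M.eval x) (fun m => ?_) rfl fun _ => hacc
      refine Eq.trans ?_ (congrArg (M.evalFrom _) (hblock (some (some r)) δ m).symm)
      by_cases h : r = δ m
      · simpa only [l, if_pos h] using hU.symm
      · simpa only [l, if_neg h] using hV.symm
  have hread : ∀ d d', (∀ κ, l κ d 0 = l κ d' 0) → d = d' := by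
    intro d d' h
    by_contra hdd
    have := h (some (some d))
    simp only [l, if_true, if_neg hdd] at this
    exact hUV this
  refine isT1_of_step (ι := Option (Option D) × Fin (n * n)) (none, ⟨0, hN⟩)
    (fun c c' => ∃ δ : ℕ → D, (∀ m, C (δ m) (δ (m + 1))) ∧ ∃ t,
      c = blockWindow (n * n) l δ t ∧ c' = blockWindow (n * n) l δ (t + 1)) ?_ ?_
  · intro z hz
    obtain ⟨δ, hδ, t, hzt⟩ := exists_eq_blockWindow (l := l) hN
      (fun δ δ' t t' h => modEq_of_phaseWord hn0 huv fun s hs => congrFun h (some none, ⟨s, hs⟩))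
      hread hz
    rintro ⟨κ, s⟩
    have := hS.shift_mem (hcol κ δ hδ) (t + s)
    simpa only [hzt, blockWindow, add_right_comm] using this
  · intro y hy
    set δ : ℕ → D := fun m => (M.eval (initWord y (n * n * m)), fun i => y (n * n * m + i))
      with hδ_def
    have hl : ∀ m, ∀ i < n * n, l none (δ m) i = y (n * n * m + i) := by
      intro m i hi
      simp only [l, hδ_def, Nat.mod_eq_of_lt hi]
    refine ⟨blockWindow (n * n) l δ, fun j => ⟨δ, fun m => ⟨⟨_, rfl⟩, ?_, ?_⟩, j, rfl, rfl⟩,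
      fun j => ?_⟩
    · rw [← DFA.mem_accepts, hM]
      exact initWord_mem_lang hy _
    · rw [initWord_congr (hl m)]
      simp only [hδ_def]
      rw [mul_add, mul_one, initWord_add, DFA.eval, DFA.evalFrom_of_append]
    · simp only [blockWindow, blockConcat, add_zero]
      rw [hl _ _ (Nat.mod_lt _ hN), Nat.div_add_mod]
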